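/- For all positive integers s and n, the Klee function evaluated at n^s equals the Jordan totient function of n: Φ_s(n^s) = J_s(n). -/

import Mathlib

open scoped Classical

/-- The generalized gcd `(a, b)_s`: the largest positive integer of the form `l ^ s`
(`l ∈ ℕ`) dividing both `a` and `b`. -/
noncomputable def sgcd (s : ℕ) (a b : ℤ) : ℕ :=
  sSup {m : ℕ | 0 < m ∧ (∃ l : ℕ, m = l ^ s) ∧ (m : ℤ) ∣ a ∧ (m : ℤ) ∣ b}

/-- Klee's function `Φ_s(n)`: the number of `m` with `1 ≤ m ≤ n` and `(m, n)_s = 1`. -/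
noncomputable def klee (s n : ℕ) : ℕ :=
  ((Finset.Icc 1 n).filter (fun m => sgcd s (m : ℤ) (n : ℤ) = 1)).card
/-- The Jordan totient function `J_s(n)`: the number of `s`-tuples `(a₁, …, a_s)`
of integers with `1 ≤ aᵢ ≤ n` such that `gcd(a₁, …, a_s, n) = 1`. -/
def jordanTotient (s n : ℕ) : ℕ :=
  ((Fintype.piFinset (fun _ : Fin s => Finset.Icc 1 n)).filter
    (fun a => (List.ofFn a).foldr Nat.gcd n = 1)).card

/-- Möbius counting: the number of elements at which a function with values in the divisors
of `n` equals `1` is determined by how many values each `d ∣ n` divides. -/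
theorem card_filter_eq_one_eq_sum_moebius {α : Type*} (S : Finset α) (g : α → ℕ) (n : ℕ)
    (hn : 0 < n) (hg : ∀ a ∈ S, g a ∣ n) :
    ((S.filter (fun a => g a = 1)).card : ℤ) =
      ∑ d ∈ n.divisors, ArithmeticFunction.moebius d * (S.filter (fun a => d ∣ g a)).card := by
  simp only [Finset.card_filter, Nat.cast_sum, Finset.mul_sum]
  rw [Finset.sum_comm]
  refine Finset.sum_congr rfl fun a ha => ?_
  have h : ∑ d ∈ (g a).divisors, ArithmeticFunction.moebius d = if g a = 1 then 1 else 0 := by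
    rw [← ArithmeticFunction.coe_mul_zeta_apply, ArithmeticFunction.moebius_mul_coe_zeta,
      ArithmeticFunction.one_apply]
  have hd : (g a).divisors = n.divisors.filter (fun d => d ∣ g a) := by
    ext d
    have h0 : g a ≠ 0 := fun h => by
      have := hg a ha
      rw [h, zero_dvd_iff] at this
      omega
    simp only [Nat.mem_divisors, Finset.mem_filter]
    exact ⟨fun h => ⟨⟨h.1.trans (hg a ha), hn.ne'⟩, h.1⟩, fun h => ⟨h.2, h0⟩⟩
  rw [hd, Finset.sum_filter] at h
  simp only [Nat.cast_ite, Nat.cast_one, Nat.cast_zero, mul_ite, mul_one, mul_zero]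
  exact h.symm

/-- The least common multiple of the divisors `d` of `n` with `d ^ s ∣ m`. -/
def powDivisorsLcm (s n m : ℕ) : ℕ :=
  (n.divisors.filter (fun d => d ^ s ∣ m)).lcm id

theorem powDivisorsLcm_dvd (s n m : ℕ) : powDivisorsLcm s n m ∣ n :=
  Finset.lcm_dvd fun _ hd => Nat.dvd_of_mem_divisors (Finset.mem_filter.1 hd).1

theorem powDivisorsLcm_pow_dvd (s n m : ℕ) : powDivisorsLcm s n m ^ s ∣ m := by
  have key : ∀ T : Finset ℕ, (∀ d ∈ T, d ^ s ∣ m) → (T.lcm id) ^ s ∣ m := by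
    intro T
    induction T using Finset.induction_on with
    | empty => simp
    | insert a T ha ih =>
      intro h
      rw [Finset.lcm_insert, id, lcm_eq_nat_lcm, ← Nat.pow_lcm_pow]
      exact Nat.lcm_dvd (h a (Finset.mem_insert_self a T))
        (ih fun d hd => h d (Finset.mem_insert_of_mem hd))
  exact key _ fun d hd => (Finset.mem_filter.1 hd).2

theorem dvd_powDivisorsLcm_iff {s n m d : ℕ} (hn : 0 < n) (hd : d ∣ n) :
    d ∣ powDivisorsLcm s n m ↔ d ^ s ∣ m := by
  refine ⟨fun h => (pow_dvd_pow_of_dvd h s).trans (powDivisorsLcm_pow_dvd s n m), fun h => ?_⟩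
  exact Finset.dvd_lcm (f := id)
    (Finset.mem_filter.2 ⟨Nat.mem_divisors.2 ⟨hd, hn.ne'⟩, h⟩)

theorem sgcd_pow_eq_one_iff {s n m : ℕ} (hs : 0 < s) (hn : 0 < n) :
    sgcd s (m : ℤ) ((n ^ s : ℕ) : ℤ) = 1 ↔ powDivisorsLcm s n m = 1 := by
  set g := powDivisorsLcm s n m with hg
  have hgpos : 0 < g := Nat.pos_of_dvd_of_pos (powDivisorsLcm_dvd s n m) hn
  have hmax : IsGreatest {k : ℕ | 0 < k ∧ (∃ l : ℕ, k = l ^ s) ∧ (k : ℤ) ∣ (m : ℤ) ∧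
      (k : ℤ) ∣ ((n ^ s : ℕ) : ℤ)} (g ^ s) := by
    refine ⟨⟨pow_pos hgpos s, ⟨g, rfl⟩, Int.natCast_dvd_natCast.2 (powDivisorsLcm_pow_dvd s n m),
      Int.natCast_dvd_natCast.2 (pow_dvd_pow_of_dvd (powDivisorsLcm_dvd s n m) s)⟩, ?_⟩
    rintro _ ⟨_, ⟨l, rfl⟩, hm, hl⟩
    rw [Int.natCast_dvd_natCast] at hm hl
    have hln : l ∣ n := (Nat.pow_dvd_pow_iff hs.ne').1 hl
    exact Nat.pow_le_pow_left (Nat.le_of_dvd hgpos ((dvd_powDivisorsLcm_iff hn hln).2 hm)) s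
  rw [sgcd, hmax.csSup_eq, Nat.pow_eq_one, or_iff_left hs.ne']

theorem dvd_foldr_gcd_iff (d n : ℕ) (l : List ℕ) :
    d ∣ l.foldr Nat.gcd n ↔ d ∣ n ∧ ∀ x ∈ l, d ∣ x := by
  induction l with
  | nil => simp
  | cons a l ih =>
    simp only [List.foldr_cons, Nat.dvd_gcd_iff, ih, List.forall_mem_cons]
    tauto

theorem card_filter_dvd_Icc (N p : ℕ) :
    ((Finset.Icc 1 N).filter (fun m => p ∣ m)).card = N / p := by
  rw [← Nat.Ioc_filter_dvd_card_eq_div]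
  congr 1

theorem card_filter_dvd_foldr_gcd {s n d : ℕ} (hd : d ∣ n) :
    ((Fintype.piFinset (fun _ : Fin s => Finset.Icc 1 n)).filter
      (fun a => d ∣ (List.ofFn a).foldr Nat.gcd n)).card = (n / d) ^ s := by
  have h : (Fintype.piFinset (fun _ : Fin s => Finset.Icc 1 n)).filter
      (fun a => d ∣ (List.ofFn a).foldr Nat.gcd n) =
      Fintype.piFinset (fun _ : Fin s => (Finset.Icc 1 n).filter (fun m => d ∣ m)) := by
    ext a
    simp only [Finset.mem_filter, Fintype.mem_piFinset, dvd_foldr_gcd_iff, List.forall_mem_ofFn_iff,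
      forall_and, hd, true_and]
  rw [h, Fintype.card_piFinset_const, card_filter_dvd_Icc]

/-- In the definition of `klee` the interval is coerced to a finset of integers; here the count runs
over the natural numbers themselves. -/
theorem klee_eq_card_filter_natCast (s n : ℕ) :
    klee s n = ((Finset.Icc 1 n).filter (fun m : ℕ => sgcd s (m : ℤ) (n : ℤ) = 1)).card := by
  have h : (do let a ← Finset.Icc 1 n; pure (a : ℤ)) =
      (Finset.Icc 1 n).image (fun a : ℕ => (a : ℤ)) := by
    ext x
    simp [Finset.bind_def, Finset.pure_def, eq_comm]
  rw [klee, h, Finset.filter_image, Finset.card_image_of_injective _ Nat.cast_injective]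

theorem klee_pow_eq_jordanTotient (s n : ℕ) (hs : 0 < s) (hn : 0 < n) :
    klee s (n ^ s) = jordanTotient s n := by
  simp only [klee_eq_card_filter_natCast, jordanTotient, sgcd_pow_eq_one_iff hs hn]
  rw [← Nat.cast_inj (R := ℤ),
    card_filter_eq_one_eq_sum_moebius _ _ n hn fun m _ => powDivisorsLcm_dvd s n m]
  have hJ := card_filter_eq_one_eq_sum_moebius
    (Fintype.piFinset (fun _ : Fin s => Finset.Icc 1 n))
    (fun a => (List.ofFn a).foldr Nat.gcd n) n hn
    fun a _ => ((dvd_foldr_gcd_iff _ n (List.ofFn a)).1 dvd_rfl).1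
  convert hJ.symm using 1
  refine Finset.sum_congr rfl fun d hd => ?_
  have hdn := Nat.dvd_of_mem_divisors hd
  rw [card_filter_dvd_foldr_gcd hdn, Nat.div_pow hdn, ← card_filter_dvd_Icc]
  simp only [dvd_powDivisorsLcm_iff hn hdn]
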